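/- Let n = 3 and d ∈ ℕ. Let (Λ,η) be a special isothermic surface in S³ of type d with respect to a polynomial conserved quantity p(t), which is not a special isothermic surface of type d−1, and let Λ̂ be a Darboux transform of (Λ,η) with parameter m. If (Λ̂,η̂) is a special isothermic surface of type d with respect to a polynomial conserved quantity p̂(t) satisfying p̂(0) = p(0), then p(m) is a section of Λ̂^⊥. -/

import Mathlib

noncomputable section

open Finset

/-- Minkowski space `ℝ^{n+1,1}`, modelled on `Fin (n+2) → ℝ`. -/
abbrev MV (n : ℕ) : Type := EuclideanSpace ℝ (Fin (n + 2))

/-- The Minkowski inner product of signature `(n+1,1)`. -/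
def mink (n : ℕ) (x y : MV n) : ℝ :=
  ∑ i : Fin (n + 1), x i.castSucc * y i.castSucc
    - x (Fin.last (n + 1)) * y (Fin.last (n + 1))

/-- The light cone `L ⊂ ℝ^{n+1,1}`. -/
def LightCone (n : ℕ) : Set (MV n) := {v | v ≠ 0 ∧ mink n v v = 0}

/-- The skew endomorphism `u ∧ v`, acting by `(u ∧ v) w = (u,w)v − (v,w)u`. -/
def wedge (n : ℕ) (u v w : MV n) : MV n :=
  mink n u w • v - mink n v w • u

/-- The surface domain: a two-dimensional coordinate chart. -/
abbrev Surf : Type := ℝ × ℝ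

/-- the coordinate direction ∂/∂u -/
def du : Surf := (1, 0)

/-- the coordinate direction ∂/∂v -/
def dv : Surf := (0, 1)

/-- partial derivative of a section in a coordinate direction -/
def pd {n : ℕ} (e : Surf) (f : Surf → MV n) (x : Surf) : MV n :=
  fderiv ℝ f x e

lemma mink_add_left (n : ℕ) (a b c : MV n) :
    mink n (a + b) c = mink n a c + mink n b c := by
  simp [mink, PiLp.add_apply, add_mul, Finset.sum_add_distrib]; ring

lemma mink_smul_left (n : ℕ) (r : ℝ) (a c : MV n) :
    mink n (r • a) c = r * mink n a c := by
  simp [mink, PiLp.smul_apply, smul_eq_mul, mul_sub, Finset.mul_sum, mul_assoc]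

lemma mink_zero_left (n : ℕ) (c : MV n) : mink n 0 c = 0 := by
  simp [mink]

/-- An isothermic surface `(Λ,η)` in `S^n = P(L)`, given by a nowhere-zero null
lift `F` of the immersion `Λ` together with the 1-form
`η = F ∧ W₁ du + F ∧ W₂ dv` with values in `Λ ∧ Λ^⊥`. -/
structure IsothermicSurface (n : ℕ) : Type where
  F : Surf → MV n
  W₁ : Surf → MV n
  W₂ : Surf → MV n
  smooth_F : ContDiff ℝ (⊤ : ℕ∞) F
  smooth_W₁ : ContDiff ℝ (⊤ : ℕ∞) W₁
  smooth_W₂ : ContDiff ℝ (⊤ : ℕ∞) W₂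
  F_ne : ∀ x, F x ≠ 0
  F_null : ∀ x, mink n (F x) (F x) = 0
  immersed : ∀ x, LinearIndependent ℝ ![F x, pd du F x, pd dv F x]
  W₁_perp : ∀ x, mink n (F x) (W₁ x) = 0
  W₂_perp : ∀ x, mink n (F x) (W₂ x) = 0
  eta_ne : ∃ x z, wedge n (F x) (W₁ x) z ≠ 0 ∨ wedge n (F x) (W₂ x) z ≠ 0
  eta_closed : ∀ x z,
    fderiv ℝ (fun y => wedge n (F y) (W₂ y) z) x du
      = fderiv ℝ (fun y => wedge n (F y) (W₁ y) z) x dv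

/-- `s` is a parallel section for the flat connection `∇^t = d + tη`. -/
def ParallelSection (n : ℕ) (S : IsothermicSurface n) (t : ℝ)
    (s : Surf → MV n) : Prop :=
  ∀ x, fderiv ℝ s x du + t • wedge n (S.F x) (S.W₁ x) (s x) = 0
     ∧ fderiv ℝ s x dv + t • wedge n (S.F x) (S.W₂ x) (s x) = 0

/-- A polynomial conserved quantity of degree `d` of the isothermic surface
`(Λ,η)`: a polynomial `p(t) = Σ_{k=0}^d p_k t^k` of (smooth) sections, of exact
degree `d`, with `∇^t p(t) = 0` for all `t`. -/
structure PolyConservedQuantity (n : ℕ) (S : IsothermicSurface n) (d : ℕ) : Type where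
  coeff : ℕ → Surf → MV n
  smooth : ∀ k, ContDiff ℝ (⊤ : ℕ∞) (coeff k)
  coeff_eq_zero : ∀ k, d < k → coeff k = 0
  top_ne : coeff d ≠ 0
  conserved : ∀ t : ℝ, ParallelSection n S t
    (fun x => ∑ k ∈ Finset.range (d + 1), t ^ k • coeff k x)

/-- evaluation `p(t)` of a polynomial conserved quantity -/
def pcEval {n : ℕ} {S : IsothermicSurface n} {d : ℕ}
    (p : PolyConservedQuantity n S d) (t : ℝ) (x : Surf) : MV n :=
  ∑ k ∈ Finset.range (d + 1), t ^ k • p.coeff k x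

/-- `(Λ,η)` is a special isothermic surface of type `d`. -/
def SpecialOfType (n : ℕ) (S : IsothermicSurface n) (d : ℕ) : Prop :=
  Nonempty (PolyConservedQuantity n S d)

/-- `p₀ ∈ ⟨w⟩`: the polynomial conserved quantity exhibits `(Λ,η)` as special
isothermic in the space-form `E(w)`. -/
def InSpaceForm {n : ℕ} {S : IsothermicSurface n} {d : ℕ}
    (p : PolyConservedQuantity n S d) (w : MV n) : Prop :=
  ∃ c : ℝ, ∀ x, p.coeff 0 x = c • w

/-- fullness: the image of `Λ` lies in no proper subsphere -/
def Full (n : ℕ) (S : IsothermicSurface n) : Prop :=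
  ¬ ∃ p : MV n, p ≠ 0 ∧ ∀ x, mink n p (S.F x) = 0
/-- A Darboux transform `Λ̂` of `(Λ,η)` with parameter `m`, given by a
`∇^m`-parallel null lift `G` spanning an immersed surface with `Λ̂ ∩ Λ = 0`. -/
structure DarbouxTransform (n : ℕ) (S : IsothermicSurface n) (m : ℝ) : Type where
  G : Surf → MV n
  smooth_G : ContDiff ℝ (⊤ : ℕ∞) G
  G_ne : ∀ x, G x ≠ 0
  G_null : ∀ x, mink n (G x) (G x) = 0
  immersed : ∀ x, LinearIndependent ℝ ![G x, pd du G x, pd dv G x]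
  disjoint : ∀ x, G x ∉ Submodule.span ℝ {S.F x}
  parallel : ParallelSection n S m G

/-- The gauge transformation `Γ_{⟨F⟩}^{⟨G⟩}(c)`: acts as `c` on `⟨G⟩`, as `1` on
`(⟨F⟩ ⊕ ⟨G⟩)^⊥` and as `c⁻¹` on `⟨F⟩`. -/
def gaugeG (n : ℕ) (F G : MV n) (c : ℝ) (z : MV n) : MV n :=
  ((mink n G z / mink n F G) / c) • F
    + (c * (mink n F z / mink n F G)) • G
    + (z - (mink n G z / mink n F G) • F - (mink n F z / mink n F G) • G)

/-- `Γ_Λ^{Λ̂}(1 − t/m) · (d + tη) = d + tη̂` for all `t ≠ m`: the gauge relation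
between the pencils of flat connections of an isothermic surface `S` and of (an
isothermic structure `T` on) its Darboux transform with parameter `m`. -/
def GaugeRel (n : ℕ) (S T : IsothermicSurface n) (m : ℝ) : Prop :=
  ∀ t : ℝ, t ≠ m → ∀ s : Surf → MV n, ContDiff ℝ (⊤ : ℕ∞) s → ∀ x : Surf,
    (fderiv ℝ (fun y => gaugeG n (S.F y) (T.F y) (1 - t / m) (s y)) x du
        + t • wedge n (T.F x) (T.W₁ x) (gaugeG n (S.F x) (T.F x) (1 - t / m) (s x))
      = gaugeG n (S.F x) (T.F x) (1 - t / m)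
          (fderiv ℝ s x du + t • wedge n (S.F x) (S.W₁ x) (s x)))
    ∧ (fderiv ℝ (fun y => gaugeG n (S.F y) (T.F y) (1 - t / m) (s y)) x dv
        + t • wedge n (T.F x) (T.W₂ x) (gaugeG n (S.F x) (T.F x) (1 - t / m) (s x))
      = gaugeG n (S.F x) (T.F x) (1 - t / m)
          (fderiv ℝ s x dv + t • wedge n (S.F x) (S.W₂ x) (s x)))

/-- `Λ̂ = ⟨p(m)⟩` with `(p(m),p(m)) = 0`: the Darboux transform `D` is a
complementary surface of `(Λ,η)` with respect to `p(t)`. -/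
def IsComplementary (n : ℕ) {S : IsothermicSurface n} {d : ℕ}
    (p : PolyConservedQuantity n S d) {m : ℝ} (D : DarbouxTransform n S m) : Prop :=
  (∀ x, mink n (pcEval p m x) (pcEval p m x) = 0) ∧
  (∀ x, Submodule.span ℝ {D.G x} = Submodule.span ℝ {pcEval p m x})

/-- `m` is a repeated root of the (constant-coefficient) polynomial `(p(t),p(t))`. -/
def IsRepeatedRootAt {n : ℕ} {S : IsothermicSurface n} {d : ℕ}
    (p : PolyConservedQuantity n S d) (m : ℝ) : Prop :=
  ∀ x, mink n (pcEval p m x) (pcEval p m x) = 0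
    ∧ deriv (fun t : ℝ => mink n (pcEval p t x) (pcEval p t x)) m = 0
/-- metric coefficient `g₁₁ = (F_u,F_u)` of the induced metric -/
def gUU (n : ℕ) (F : Surf → MV n) (x : Surf) : ℝ := mink n (pd du F x) (pd du F x)

/-- metric coefficient `g₁₂ = (F_u,F_v)` -/
def gUV (n : ℕ) (F : Surf → MV n) (x : Surf) : ℝ := mink n (pd du F x) (pd dv F x)

/-- metric coefficient `g₂₂ = (F_v,F_v)` -/
def gVV (n : ℕ) (F : Surf → MV n) (x : Surf) : ℝ := mink n (pd dv F x) (pd dv F x)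

/-- `(𝐇, N)`, the inner product of the mean curvature vector of `F` (in a
space-form `E(w)`) with a normal field `N`: half the trace with respect to the
induced metric of the `N`-component of the second fundamental form. -/
def meanCurv (n : ℕ) (F N : Surf → MV n) (x : Surf) : ℝ :=
  (gVV n F x * mink n (pd du (pd du F) x) (N x)
    - 2 * gUV n F x * mink n (pd du (pd dv F) x) (N x)
    + gUU n F x * mink n (pd dv (pd dv F) x) (N x))
  / (2 * (gUU n F x * gVV n F x - gUV n F x ^ 2))

/-- `N` is a unit normal field of the lift `F : Σ → E(w)`. -/
def IsUnitNormal (n : ℕ) (F N : Surf → MV n) (w : MV n) : Prop :=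
  (∀ x, mink n (N x) (N x) = 1) ∧ (∀ x, mink n (N x) w = 0)
    ∧ (∀ x, mink n (N x) (F x) = 0)
    ∧ (∀ x, mink n (N x) (pd du F x) = 0) ∧ (∀ x, mink n (N x) (pd dv F x) = 0)

/-- `N` is parallel for the normal connection of `F : Σ → E(w)`: the derivative
of `N` has no component in the normal bundle of `F` in `E(w)`. -/
def ParallelNormal (n : ℕ) (F N : Surf → MV n) (w : MV n) : Prop :=
  ∀ x e, fderiv ℝ N x e ∈ Submodule.span ℝ {F x, pd du F x, pd dv F x, w}

/-- the chart coordinates `(u,v)` are conformal curvature line coordinates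
corresponding to `η`, with conformal factor `e^{2θ}`:
`I = e^{2θ}(du² + dv²)` and `η = e^{−2θ} F ∧ (−F_u du + F_v dv)`. -/
def ConformalCoords (n : ℕ) (S : IsothermicSurface n) (θ : Surf → ℝ) : Prop :=
  ContDiff ℝ (⊤ : ℕ∞) θ
  ∧ (∀ x, mink n (pd du S.F x) (pd du S.F x) = Real.exp (2 * θ x))
  ∧ (∀ x, mink n (pd dv S.F x) (pd dv S.F x) = Real.exp (2 * θ x))
  ∧ (∀ x, mink n (pd du S.F x) (pd dv S.F x) = 0)
  ∧ (∀ x z, wedge n (S.F x) (S.W₁ x) z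
      = Real.exp (-(2 * θ x)) • wedge n (S.F x) (-pd du S.F x) z)
  ∧ (∀ x z, wedge n (S.F x) (S.W₂ x) z
      = Real.exp (-(2 * θ x)) • wedge n (S.F x) (pd dv S.F x) z)

/-- the second fundamental form of the lift `F` in `E(w)` with respect to the
unit normal `N` is `II = e^{2θ}(k₁ du² + k₂ dv²)`. -/
def PrincipalCurvatures (n : ℕ) (S : IsothermicSurface n) (N : Surf → MV n)
    (θ k₁ k₂ : Surf → ℝ) : Prop :=
  (∀ x, mink n (pd du (pd du S.F) x) (N x) = Real.exp (2 * θ x) * k₁ x)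
  ∧ (∀ x, mink n (pd du (pd dv S.F) x) (N x) = 0)
  ∧ (∀ x, mink n (pd dv (pd dv S.F) x) (N x) = Real.exp (2 * θ x) * k₂ x)

/-- partial derivative of a real function on the surface -/
def pdR (e : Surf) (f : Surf → ℝ) (x : Surf) : ℝ := fderiv ℝ f x e
/-- `(Λ^c, η^c)` is the Christoffel transform of `(Λ,η)` with respect to the
pair `(v∞, v₀)`, witnessed by the stereoprojections `f`, `f^c` into
`ℝ^n = ⟨v₀,v∞⟩^⊥`:  `F = exp(f ∧ v∞)v₀`, `F^c = exp(f^c ∧ v₀)v∞`,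
`η = Ad(exp(f ∧ v∞))(df^c ∧ v₀)` and `η^c = Ad(exp(f^c ∧ v₀))(df ∧ v∞)`. -/
def IsChristoffelPair (n : ℕ) (S Sc : IsothermicSurface n) (vinf v0 : MV n)
    (f fc : Surf → MV n) : Prop :=
  vinf ∈ LightCone n ∧ v0 ∈ LightCone n ∧ mink n v0 vinf = -1
  ∧ ContDiff ℝ (⊤ : ℕ∞) f ∧ ContDiff ℝ (⊤ : ℕ∞) fc
  ∧ (∀ x, mink n (f x) v0 = 0) ∧ (∀ x, mink n (f x) vinf = 0)
  ∧ (∀ x, mink n (fc x) v0 = 0) ∧ (∀ x, mink n (fc x) vinf = 0)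
  ∧ (∀ x, S.F x = v0 + f x + (mink n (f x) (f x) / 2) • vinf)
  ∧ (∀ x, Sc.F x = vinf + fc x + (mink n (fc x) (fc x) / 2) • v0)
  ∧ (∀ x z, wedge n (S.F x) (S.W₁ x) z
      = wedge n (pd du fc x + mink n (f x) (pd du fc x) • vinf) (S.F x) z)
  ∧ (∀ x z, wedge n (S.F x) (S.W₂ x) z
      = wedge n (pd dv fc x + mink n (f x) (pd dv fc x) • vinf) (S.F x) z)
  ∧ (∀ x z, wedge n (Sc.F x) (Sc.W₁ x) z
      = wedge n (pd du f x + mink n (fc x) (pd du f x) • v0) (Sc.F x) z)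
  ∧ (∀ x z, wedge n (Sc.F x) (Sc.W₂ x) z
      = wedge n (pd dv f x + mink n (fc x) (pd dv f x) • v0) (Sc.F x) z)

/-- `Φ` is an orthogonal gauge transformation with `Φ · (d + sη) = d`. -/
def IsTGauge (n : ℕ) (S : IsothermicSurface n) (s : ℝ)
    (Φ : Surf → MV n → MV n) : Prop :=
  (∀ x, IsLinearMap ℝ (Φ x))
  ∧ (∀ x z z', mink n (Φ x z) (Φ x z') = mink n z z')
  ∧ (∀ σ : Surf → MV n, ContDiff ℝ (⊤ : ℕ∞) σ → ∀ x,
      (fderiv ℝ (fun y => Φ y (σ y)) x du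
         = Φ x (fderiv ℝ σ x du + s • wedge n (S.F x) (S.W₁ x) (σ x)))
      ∧ (fderiv ℝ (fun y => Φ y (σ y)) x dv
         = Φ x (fderiv ℝ σ x dv + s • wedge n (S.F x) (S.W₂ x) (σ x))))

/-- `(Λ_s, η_s)` is the T-transform of `(Λ,η)` associated to `Φ_s`:
`Λ_s = Φ_s Λ` and `η_s = Ad(Φ_s) η`. -/
def IsTTransform (n : ℕ) (S : IsothermicSurface n) (s : ℝ)
    (Φ : Surf → MV n → MV n) (Ss : IsothermicSurface n) : Prop :=
  IsTGauge n S s Φ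
  ∧ (∀ x, Ss.F x = Φ x (S.F x))
  ∧ (∀ x z, wedge n (Ss.F x) (Ss.W₁ x) (Φ x z) = Φ x (wedge n (S.F x) (S.W₁ x) z))
  ∧ (∀ x z, wedge n (Ss.F x) (Ss.W₂ x) (Φ x z) = Φ x (wedge n (S.F x) (S.W₂ x) z))

/-- orthogonal complement with respect to the Minkowski form -/
def mperp (n : ℕ) (U : Submodule ℝ (MV n)) : Submodule ℝ (MV n) where
  carrier := {v | ∀ u ∈ U, mink n v u = 0}
  add_mem' := by
    intro a b ha hb u hu
    rw [mink_add_left, ha u hu, hb u hu, add_zero]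
  zero_mem' := by
    intro u hu; exact mink_zero_left n u
  smul_mem' := by
    intro r a ha u hu
    rw [mink_smul_left, ha u hu, mul_zero]

/-- the spherical system of `Λ` and a Darboux transform `Λ̂ = ⟨G⟩`: the
`(n−2)`-sphere congruence `C = Λ ⊕ Λ̂ ⊕ V_R^⊥`, `V_R = Λ^{(1)} ⊕ Λ̂`. -/
def sphericalSystem (n : ℕ) (S : IsothermicSurface n) (G : Surf → MV n)
    (x : Surf) : Submodule ℝ (MV n) :=
  Submodule.span ℝ {S.F x, G x}
    ⊔ mperp n (Submodule.span ℝ {S.F x, pd du S.F x, pd dv S.F x, G x})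

/-- the sphere-planes congruence `P = C + ⟨w⟩` of `Λ` and `Λ̂ = ⟨G⟩` with
respect to `w`. -/
def spherePlanes (n : ℕ) (S : IsothermicSurface n) (G : Surf → MV n)
    (w : MV n) (x : Surf) : Submodule ℝ (MV n) :=
  sphericalSystem n S G x ⊔ Submodule.span ℝ {w}
lemma mink_comm (n : ℕ) (a b : MV n) : mink n a b = mink n b a := by
  simp [mink, mul_comm]

lemma mink_add_right (n : ℕ) (a b c : MV n) :
    mink n a (b + c) = mink n a b + mink n a c := by
  rw [mink_comm, mink_add_left, mink_comm n b, mink_comm n c]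

lemma mink_smul_right (n : ℕ) (r : ℝ) (a c : MV n) :
    mink n a (r • c) = r * mink n a c := by
  rw [mink_comm, mink_smul_left, mink_comm]

lemma mink_zero_right (n : ℕ) (a : MV n) : mink n a 0 = 0 := by
  rw [mink_comm, mink_zero_left]

lemma mink_neg_left (n : ℕ) (a b : MV n) : mink n (-a) b = -mink n a b := by
  rw [← neg_one_smul ℝ a, mink_smul_left]; ring

lemma mink_neg_right (n : ℕ) (a b : MV n) : mink n a (-b) = -mink n a b := by
  rw [mink_comm, mink_neg_left, mink_comm]

lemma mink_sub_left (n : ℕ) (a b c : MV n) :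
    mink n (a - b) c = mink n a c - mink n b c := by
  rw [sub_eq_add_neg, mink_add_left, mink_neg_left]; ring

lemma mink_sub_right (n : ℕ) (a b c : MV n) :
    mink n a (b - c) = mink n a b - mink n a c := by
  rw [sub_eq_add_neg, mink_add_right, mink_neg_right]; ring

lemma mink_sum_left (n : ℕ) {ι : Type*} (s : Finset ι) (f : ι → MV n) (c : MV n) :
    mink n (∑ k ∈ s, f k) c = ∑ k ∈ s, mink n (f k) c := by
  classical
  induction s using Finset.induction_on with
  | empty => simp [mink_zero_left]
  | insert a s ha ih => rw [sum_insert ha, sum_insert ha, mink_add_left, ih]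

/-- The Minkowski form as a continuous bilinear map. -/
def minkBilin (n : ℕ) : MV n →L[ℝ] MV n →L[ℝ] ℝ :=
  ∑ i : Fin (n + 1), (EuclideanSpace.proj i.castSucc : MV n →L[ℝ] ℝ).smulRight
      (EuclideanSpace.proj i.castSucc : MV n →L[ℝ] ℝ)
    - (EuclideanSpace.proj (Fin.last (n + 1)) : MV n →L[ℝ] ℝ).smulRight
      (EuclideanSpace.proj (Fin.last (n + 1)) : MV n →L[ℝ] ℝ)

lemma minkBilin_apply (n : ℕ) (a b : MV n) : minkBilin n a b = mink n a b := by
  simp [minkBilin, mink]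

lemma ContDiff.mink {n : ℕ} {f g : Surf → MV n} (hf : ContDiff ℝ (⊤ : ℕ∞) f)
    (hg : ContDiff ℝ (⊤ : ℕ∞) g) : ContDiff ℝ (⊤ : ℕ∞) (fun x => mink n (f x) (g x)) := by
  simp only [← minkBilin_apply]
  exact ((minkBilin n).contDiff.comp hf).clm_apply hg

lemma fderiv_mink {n : ℕ} {f g : Surf → MV n} {x : Surf} (hf : DifferentiableAt ℝ f x)
    (hg : DifferentiableAt ℝ g x) (e : Surf) :
    fderiv ℝ (fun y => mink n (f y) (g y)) x e
      = mink n (f x) (fderiv ℝ g x e) + mink n (fderiv ℝ f x e) (g x) := by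
  simp only [← minkBilin_apply]
  rw [((minkBilin n).hasFDerivAt_of_bilinear hf.hasFDerivAt hg.hasFDerivAt).fderiv]
  simp

lemma ContDiff.wedge {n : ℕ} {f g h : Surf → MV n} (hf : ContDiff ℝ (⊤ : ℕ∞) f)
    (hg : ContDiff ℝ (⊤ : ℕ∞) g) (hh : ContDiff ℝ (⊤ : ℕ∞) h) :
    ContDiff ℝ (⊤ : ℕ∞) (fun x => wedge n (f x) (g x) (h x)) := by
  unfold _root_.wedge
  exact ((hf.mink hh).smul hg).sub ((hg.mink hh).smul hf)

lemma wedge_sub (n : ℕ) (u v a b : MV n) :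
    wedge n u v (a - b) = wedge n u v a - wedge n u v b := by
  simp only [wedge, mink_sub_right, sub_smul]; abel

lemma wedge_smul (n : ℕ) (u v : MV n) (r : ℝ) (a : MV n) :
    wedge n u v (r • a) = r • wedge n u v a := by
  simp only [wedge, mink_smul_right, mul_smul, smul_sub]

lemma wedge_zero (n : ℕ) (u v : MV n) : wedge n u v 0 = 0 := by
  simp [wedge, mink_zero_right]

lemma wedge_sum (n : ℕ) (u v : MV n) {ι : Type*} (s : Finset ι) (f : ι → MV n) :
    wedge n u v (∑ k ∈ s, f k) = ∑ k ∈ s, wedge n u v (f k) := by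
  simp only [wedge, mink_comm n _ (∑ k ∈ s, f k), mink_sum_left, sum_smul, sum_sub_distrib,
    mink_comm n (f _)]

/-- Skew-adjointness of `u ∧ v`. -/
lemma mink_wedge (n : ℕ) (u v a b : MV n) :
    mink n (wedge n u v a) b = -mink n a (wedge n u v b) := by
  simp only [wedge, mink_sub_left, mink_smul_left, mink_comm n a]
  ring

lemma eq_zero_of_mink_eq_zero {n : ℕ} {v : MV n} (h : ∀ z, mink n v z = 0) : v = 0 := by
  ext i
  induction i using Fin.lastCases with
  | last =>
    have := h (EuclideanSpace.single (Fin.last (n + 1)) 1)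
    simpa [mink, Fin.castSucc_ne_last] using this
  | cast i =>
    have := h (EuclideanSpace.single i.castSucc 1)
    simpa [mink, Pi.single_apply, (Fin.castSucc_ne_last _).symm] using this

lemma eq_zero_of_null_of_last {n : ℕ} {v : MV n} (h : mink n v v = 0)
    (hl : v (Fin.last (n + 1)) = 0) : v = 0 := by
  simp only [mink, hl, mul_zero, sub_zero] at h
  rw [sum_eq_zero_iff_of_nonneg (fun i _ => mul_self_nonneg _)] at h
  ext i
  induction i using Fin.lastCases with
  | last => simpa using hl
  | cast i => simpa using h i (mem_univ i)

lemma last_ne_zero_of_null {n : ℕ} {v : MV n} (h : mink n v v = 0) (hv : v ≠ 0) :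
    v (Fin.last (n + 1)) ≠ 0 := fun hl => hv (eq_zero_of_null_of_last h hl)

/-- Orthogonal null vectors of Minkowski space are proportional. -/
lemma eq_smul_of_null_of_orthogonal {n : ℕ} {v w : MV n} (hv : mink n v v = 0) (hv0 : v ≠ 0)
    (hw : mink n w w = 0) (hvw : mink n v w = 0) :
    w = (w (Fin.last (n + 1)) / v (Fin.last (n + 1))) • v := by
  have hl := last_ne_zero_of_null hv hv0
  rw [← sub_eq_zero]
  apply eq_zero_of_null_of_last
  · simp [mink_sub_left, mink_sub_right, mink_smul_left, mink_smul_right, hv, hw, hvw,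
      mink_comm n w v]
  · simp [div_mul_cancel₀ _ hl]

lemma fderiv_eq_zero_of_partials {E : Type*} [NormedAddCommGroup E] [NormedSpace ℝ E]
    {f : Surf → E} {x : Surf} (hu : fderiv ℝ f x du = 0) (hv : fderiv ℝ f x dv = 0) :
    fderiv ℝ f x = 0 := by
  ext
  · simpa [du] using hu
  · simpa [dv] using hv

/-- A vector-valued polynomial vanishing off one point has zero coefficients. -/
lemma coeff_eq_zero_of_sum_pow_smul {n N : ℕ} (m : ℝ) (v : ℕ → MV n)
    (h : ∀ t : ℝ, t ≠ m → ∑ k ∈ range N, t ^ k • v k = 0) {k : ℕ} (hk : k < N) : v k = 0 := by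
  ext i
  let P : Polynomial ℝ := ∑ k ∈ range N, Polynomial.monomial k (v k i)
  have hP : P = 0 := by
    apply Polynomial.eq_zero_of_infinite_isRoot
    refine (Set.finite_singleton m).infinite_compl.mono fun t ht => ?_
    have := congrArg (fun w : MV n => w i) (h t ht)
    simpa [P, Polynomial.eval_finsetSum, mul_comm] using this
  have := congrArg (fun Q => Polynomial.coeff Q k) hP
  simpa [P, Polynomial.coeff_monomial, hk] using this

namespace IsothermicSurface

variable {n : ℕ} (S : IsothermicSurface n)

/-- `da + ηb = 0`. -/
def DerivEq (a b : Surf → MV n) : Prop :=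
  ∀ x, fderiv ℝ a x du + wedge n (S.F x) (S.W₁ x) (b x) = 0
    ∧ fderiv ℝ a x dv + wedge n (S.F x) (S.W₂ x) (b x) = 0

/-- `ηa = 0`. -/
def EtaKills (a : Surf → MV n) : Prop :=
  ∀ x, wedge n (S.F x) (S.W₁ x) (a x) = 0 ∧ wedge n (S.F x) (S.W₂ x) (a x) = 0

/-- `η` does not vanish at `x`. -/
def EtaNeAt (x : Surf) : Prop :=
  ∃ z, wedge n (S.F x) (S.W₁ x) z ≠ 0 ∨ wedge n (S.F x) (S.W₂ x) z ≠ 0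

/-- A sequence of coefficients with `(d + tη) (∑ cₖ tᵏ) = 0` as formal power series. -/
structure IsConserved (c : ℕ → Surf → MV n) : Prop where
  smooth : ∀ k, ContDiff ℝ (⊤ : ℕ∞) (c k)
  zero : ∀ x, fderiv ℝ (c 0) x = 0
  succ : ∀ k, S.DerivEq (c (k + 1)) (c k)

variable {S}

lemma isOpen_etaNeAt : IsOpen {x | S.EtaNeAt x} := by
  have : {x | S.EtaNeAt x} = ⋃ z, ({x | wedge n (S.F x) (S.W₁ x) z ≠ 0} ∪
      {x | wedge n (S.F x) (S.W₂ x) z ≠ 0}) := by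
    ext x; simp [EtaNeAt]
  rw [this]
  refine isOpen_iUnion fun z => IsOpen.union ?_ ?_
  · exact isOpen_ne_fun (S.smooth_F.wedge S.smooth_W₁ contDiff_const).continuous continuous_const
  · exact isOpen_ne_fun (S.smooth_F.wedge S.smooth_W₂ contDiff_const).continuous continuous_const

lemma wedge_smul_self (r : ℝ) (u z : MV n) : wedge n u (r • u) z = 0 := by
  simp [wedge, mink_smul_left, smul_smul, mul_comm]

lemma EtaNeAt.mink_eq_zero {x : Surf} (hx : S.EtaNeAt x) {a : Surf → MV n}
    (ha : S.EtaKills a) : mink n (S.F x) (a x) = 0 := by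
  by_contra h
  have key : ∀ W : MV n, wedge n (S.F x) W (a x) = 0 → ∀ z, wedge n (S.F x) W z = 0 := by
    intro W hW z
    have : W = (mink n W (a x) / mink n (S.F x) (a x)) • S.F x := by
      rw [wedge, sub_eq_zero] at hW
      rw [div_eq_inv_mul, mul_smul, ← hW, smul_smul, inv_mul_cancel₀ h, one_smul]
    rw [this, wedge_smul_self]
  obtain ⟨z, hz | hz⟩ := hx
  · exact hz (key _ (ha x).1 z)
  · exact hz (key _ (ha x).2 z)

lemma mink_F_pd (S : IsothermicSurface n) (x e : Surf) : mink n (S.F x) (pd e S.F x) = 0 := by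
  have hF := (S.smooth_F.differentiable (by simp)) x
  have h := fderiv_mink hF hF e
  simp only [S.F_null, fderiv_const_apply, _root_.zero_apply] at h
  rw [mink_comm n _ (S.F x)] at h
  simp only [pd]; linarith

lemma immersed_iff (S : IsothermicSurface n) {x : Surf} {a b c : ℝ}
    (h : a • S.F x + b • pd du S.F x + c • pd dv S.F x = 0) : a = 0 ∧ b = 0 ∧ c = 0 := by
  have := Fintype.linearIndependent_iff.1 (S.immersed x) ![a, b, c]
    (by simpa [Fin.sum_univ_three] using h)
  exact ⟨this 0, this 1, this 2⟩

/-- The induced metric is nondegenerate. -/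
lemma gram_ne (S : IsothermicSurface n) (x : Surf) :
    mink n (pd du S.F x) (pd du S.F x) * mink n (pd dv S.F x) (pd dv S.F x)
      ≠ mink n (pd du S.F x) (pd dv S.F x) ^ 2 := by
  intro h
  have hli := fun a b c => S.immersed_iff (x := x) (a := a) (b := b) (c := c)
  set A := pd du S.F x
  set B := pd dv S.F x
  have hA : mink n (S.F x) A = 0 := S.mink_F_pd x du
  have hB : mink n (S.F x) B = 0 := S.mink_F_pd x dv
  have h1 := eq_smul_of_null_of_orthogonal (S.F_null x) (S.F_ne x)
    (w := mink n A A • B - mink n A B • A)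
    (by simp only [mink_sub_left, mink_sub_right, mink_smul_left, mink_smul_right, mink_comm n B A]
        linear_combination mink n A A * h)
    (by simp [mink_sub_right, mink_smul_right, hA, hB])
  obtain ⟨-, -, hAA⟩ := hli (-(_ / _)) (-mink n A B) (mink n A A)
    (by rw [neg_smul, ← h1]; module)
  have h2 := eq_smul_of_null_of_orthogonal (S.F_null x) (S.F_ne x) hAA hA
  obtain ⟨-, h3, -⟩ := hli (-(_ / _)) 1 0 (by rw [neg_smul, ← h2]; module)
  exact one_ne_zero h3

/-- If `η = k F ∧ dF` at a point, then `k = 0`. -/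
lemma not_conformal (S : IsothermicSurface n) {x : Surf} {k r₁ r₂ : ℝ}
    (h₁ : S.W₁ x = k • pd du S.F x + r₁ • S.F x)
    (h₂ : S.W₂ x = k • pd dv S.F x + r₂ • S.F x) : k = 0 := by
  by_contra hk
  have hF := (S.smooth_F.differentiable (by simp)) x
  have hd : ∀ W : Surf → MV n, ContDiff ℝ (⊤ : ℕ∞) W → ∀ (e : Surf) (z y : MV n),
      mink n (S.F x) z = 0 → mink n (S.F x) y = 0 →
      mink n (fderiv ℝ (fun y => wedge n (S.F y) (W y) z) x e) y
        = mink n (pd e S.F x) z * mink n (W x) y - mink n (W x) z * mink n (pd e S.F x) y := by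
    intro W hW e z y hz hy
    have hwd := ((S.smooth_F.wedge hW (contDiff_const (c := z))).differentiable (by simp)) x
    have e1 := fderiv_mink hwd (differentiableAt_const y) e
    have e2 : (fun q => mink n (wedge n (S.F q) (W q) z) y)
        = fun q => mink n (S.F q) z * mink n (W q) y - mink n (W q) z * mink n (S.F q) y := by
      funext q; simp [wedge, mink_sub_left, mink_smul_left]
    have d1 : ∀ w : MV n, DifferentiableAt ℝ (fun q => mink n (S.F q) w) x := fun w =>
      ((S.smooth_F.mink contDiff_const).differentiable (by simp)) x
    have d2 : ∀ w : MV n, DifferentiableAt ℝ (fun q => mink n (W q) w) x := fun w =>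
      ((hW.mink contDiff_const).differentiable (by simp)) x
    rw [e2, fderiv_fun_sub ((d1 z).fun_mul (d2 y)) ((d2 z).fun_mul (d1 y)),
      fderiv_fun_mul (d1 z) (d2 y), fderiv_fun_mul (d2 z) (d1 y)] at e1
    simp only [_root_.sub_apply, _root_.add_apply,
      _root_.smul_apply, smul_eq_mul, fderiv_mink hF (differentiableAt_const _),
      fderiv_fun_const, Pi.zero_apply, _root_.zero_apply, mink_zero_right, hz, hy,
      zero_mul, zero_add] at e1
    simp only [pd]
    linarith
  have hu := S.mink_F_pd x du
  have hv := S.mink_F_pd x dv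
  have hc := congrArg (fun w => mink n w (pd dv S.F x)) (S.eta_closed x (pd du S.F x))
  simp only [hd _ S.smooth_W₁ _ _ _ hu hv, hd _ S.smooth_W₂ _ _ _ hu hv, h₁, h₂, mink_add_left,
    mink_smul_left, hu, hv, mink_comm n (pd dv S.F x) (pd du S.F x)] at hc
  apply S.gram_ne x
  have : 2 * k ≠ 0 := by positivity
  apply mul_left_cancel₀ this
  linear_combination hc

/-- A section which vanishes wherever `η` does not, and whose derivative vanishes with `η`,
vanishes identically. -/
lemma DerivEq.eq_zero {a b : Surf → MV n} (ha : ContDiff ℝ (⊤ : ℕ∞) a) (h : S.DerivEq a b)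
    (h0 : ∀ x, S.EtaNeAt x → a x = 0) : a = 0 := by
  have hd : ∀ x, fderiv ℝ a x = 0 := by
    intro x
    by_cases hx : S.EtaNeAt x
    · have : a =ᶠ[nhds x] fun _ => 0 := by
        filter_upwards [isOpen_etaNeAt.mem_nhds hx] with y hy using h0 y hy
      rw [this.fderiv_eq]; simp
    · simp only [EtaNeAt, not_exists, not_or, not_not] at hx
      have := h x
      rw [(hx _).1, (hx _).2, add_zero, add_zero] at this
      exact fderiv_eq_zero_of_partials this.1 this.2
  obtain ⟨x₀, hx₀⟩ := S.eta_ne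
  funext x
  rw [is_const_of_fderiv_eq_zero (ha.differentiable (by simp)) hd x x₀]
  exact h0 x₀ hx₀

/-- A null top coefficient of a conserved quantity vanishes. -/
lemma eq_zero_of_null {a b : Surf → MV n} (ha : ContDiff ℝ (⊤ : ℕ∞) a) (h : S.DerivEq a b)
    (hk : S.EtaKills a) (hn : ∀ x, mink n (a x) (a x) = 0) : a = 0 := by
  refine h.eq_zero ha fun x hx => ?_
  set f : Surf → ℝ := fun y => a y (Fin.last (n + 1)) / S.F y (Fin.last (n + 1)) with hf
  have hfa : ∀ y, S.EtaNeAt y → a y = f y • S.F y := fun y hy =>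
    eq_smul_of_null_of_orthogonal (S.F_null y) (S.F_ne y) (hn y) (hy.mink_eq_zero hk)
  have hlast : ∀ g : Surf → MV n, ContDiff ℝ (⊤ : ℕ∞) g →
      ContDiff ℝ (⊤ : ℕ∞) fun y => g y (Fin.last (n + 1)) := fun g hg =>
    (EuclideanSpace.proj (𝕜 := ℝ) (Fin.last (n + 1))).contDiff.comp hg
  have hfd : DifferentiableAt ℝ f x := (((hlast a ha).div (hlast _ S.smooth_F) fun y =>
    last_ne_zero_of_null (S.F_null y) (S.F_ne y)).differentiable (by simp)) x
  have hF := (S.smooth_F.differentiable (by simp)) x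
  have hEq : a =ᶠ[nhds x] fun y => f y • S.F y := by
    filter_upwards [isOpen_etaNeAt.mem_nhds hx] with y hy using hfa y hy
  by_contra hax
  have hfx : f x ≠ 0 := fun h0 => hax (by rw [hfa x hx, h0, zero_smul])
  set l := mink n (S.F x) (b x) with hl
  have comp : ∀ (e : Surf) (W : MV n), fderiv ℝ a x e + wedge n (S.F x) W (b x) = 0 →
      f x • pd e S.F x + (fderiv ℝ f x e - mink n W (b x)) • S.F x + l • W = 0 := by
    intro e W hW
    rw [hEq.fderiv_eq, fderiv_fun_smul hfd hF] at hW
    rw [← hW]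
    simp only [_root_.add_apply, _root_.smul_apply,
      ContinuousLinearMap.smulRight_apply, wedge, pd]
    module
  have hu := comp du _ (h x).1
  have hv := comp dv _ (h x).2
  have hl0 : l ≠ 0 := by
    intro h0
    rw [h0, zero_smul, add_zero] at hu
    exact hfx (S.immersed_iff (x := x) (a := fderiv ℝ f x du - mink n (S.W₁ x) (b x)) (c := 0)
      (by linear_combination (norm := module) hu)).2.1
  have solve : ∀ (e W : MV n) (r : ℝ), f x • e + r • S.F x + l • W = 0 →
      W = (-(f x / l)) • e + (-(r / l)) • S.F x := by
    intro e W r hW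
    apply smul_right_injective _ hl0
    have h1 : l * -(f x / l) = -f x := by field_simp
    have h2 : l * -(r / l) = -r := by field_simp
    simp only [smul_add, smul_smul, h1, h2]
    linear_combination (norm := module) hW
  have := S.not_conformal (solve _ _ _ hu) (solve _ _ _ hv)
  rw [neg_eq_zero, div_eq_zero_iff] at this
  exact this.elim hfx hl0

/-- Top coefficients of conserved quantities have constant inner products. -/
lemma mink_top_const {a a' b b' : Surf → MV n} (ha : ContDiff ℝ (⊤ : ℕ∞) a)
    (hb : ContDiff ℝ (⊤ : ℕ∞) b) (h : S.DerivEq a a') (h' : S.DerivEq b b')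
    (hk : S.EtaKills a) (hk' : S.EtaKills b) (x y : Surf) :
    mink n (a x) (b x) = mink n (a y) (b y) := by
  refine is_const_of_fderiv_eq_zero (f := fun x => mink n (a x) (b x))
    ((ha.mink hb).differentiable (by simp)) (fun x => ?_) x y
  have hda := (ha.differentiable (by simp)) x
  have hdb := (hb.differentiable (by simp)) x
  apply fderiv_eq_zero_of_partials
  · rw [fderiv_mink hda hdb, eq_neg_of_add_eq_zero_left (h x).1,
      eq_neg_of_add_eq_zero_left (h' x).1, mink_neg_left, mink_neg_right, mink_wedge, (hk' x).1,
      mink_comm n (a x), mink_wedge, (hk x).1]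
    simp [mink_zero_right]
  · rw [fderiv_mink hda hdb, eq_neg_of_add_eq_zero_left (h x).2,
      eq_neg_of_add_eq_zero_left (h' x).2, mink_neg_left, mink_neg_right, mink_wedge, (hk' x).2,
      mink_comm n (a x), mink_wedge, (hk x).2]
    simp [mink_zero_right]

/-- Where `η ≠ 0`, a top coefficient is orthogonal to the tangent spheres. -/
lemma EtaNeAt.mink_pd_eq_zero {x : Surf} (hx : S.EtaNeAt x) {a b : Surf → MV n}
    (ha : ContDiff ℝ (⊤ : ℕ∞) a) (h : S.DerivEq a b) (hk : S.EtaKills a) :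
    mink n (a x) (pd du S.F x) = 0 ∧ mink n (a x) (pd dv S.F x) = 0 := by
  have hda := (ha.differentiable (by simp)) x
  have hF := (S.smooth_F.differentiable (by simp)) x
  have h0 : (fun y => mink n (a y) (S.F y)) =ᶠ[nhds x] fun _ => 0 := by
    filter_upwards [isOpen_etaNeAt.mem_nhds hx] with y hy
    rw [mink_comm, hy.mink_eq_zero hk]
  have key : ∀ (e : Surf) (W : MV n), mink n (S.F x) W = 0 →
      fderiv ℝ a x e + wedge n (S.F x) W (b x) = 0 → mink n (a x) (pd e S.F x) = 0 := by
    intro e W hW hd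
    have := fderiv_mink hda hF e
    rw [h0.fderiv_eq, eq_neg_of_add_eq_zero_left hd] at this
    simpa [pd, wedge, mink_neg_left, mink_sub_left, mink_smul_left, mink_comm n W, hW, S.F_null]
      using this.symm
  exact ⟨key du _ (S.W₁_perp x) (h x).1, key dv _ (S.W₂_perp x) (h x).2⟩

/-- In `S³`, two top coefficients of conserved quantities have vanishing Gram determinant. -/
lemma gram_top_eq_zero {S : IsothermicSurface 3} {a a' b b' : Surf → MV 3}
    (ha : ContDiff ℝ (⊤ : ℕ∞) a) (hb : ContDiff ℝ (⊤ : ℕ∞) b) (h : S.DerivEq a a')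
    (h' : S.DerivEq b b') (hk : S.EtaKills a) (hk' : S.EtaKills b) {x : Surf}
    (hx : S.EtaNeAt x) :
    mink 3 (a x) (a x) * mink 3 (b x) (b x) - mink 3 (a x) (b x) ^ 2 = 0 := by
  by_contra hne
  obtain ⟨hau, hav⟩ := hx.mink_pd_eq_zero ha h hk
  obtain ⟨hbu, hbv⟩ := hx.mink_pd_eq_zero hb h' hk'
  have hFa := hx.mink_eq_zero hk
  have hFb := hx.mink_eq_zero hk'
  have hFu := S.mink_F_pd x du
  have hFv := S.mink_F_pd x dv
  have hli : LinearIndependent ℝ ![S.F x, pd du S.F x, pd dv S.F x, a x, b x] := by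
    rw [Fintype.linearIndependent_iff]
    intro g hg
    have hg' : g 0 • S.F x + g 1 • pd du S.F x + g 2 • pd dv S.F x + g 3 • a x + g 4 • b x
        = 0 := by simpa [Fin.sum_univ_five] using hg
    have e1 := congrArg (mink 3 (a x)) hg'
    have e2 := congrArg (mink 3 (b x)) hg'
    simp only [mink_add_right, mink_smul_right, mink_zero_right, hau, hav, hbu, hbv,
      mink_comm 3 _ (S.F x), hFa, hFb, mink_comm 3 (b x) (a x), mul_zero, zero_add] at e1 e2
    have h3 : g 3 = 0 := by
      apply (mul_eq_zero.1 _).resolve_right hne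
      linear_combination mink 3 (b x) (b x) * e1 - mink 3 (a x) (b x) * e2
    have h4 : g 4 = 0 := by
      apply (mul_eq_zero.1 _).resolve_right hne
      linear_combination mink 3 (a x) (a x) * e2 - mink 3 (a x) (b x) * e1
    rw [h3, h4, zero_smul, zero_smul, add_zero, add_zero] at hg'
    obtain ⟨h0, h1, h2⟩ := S.immersed_iff hg'
    intro i
    fin_cases i <;> assumption
  have hspan := hli.span_eq_top_of_card_eq_finrank (by simp)
  apply S.F_ne x
  apply eq_zero_of_mink_eq_zero
  intro z
  have hz : z ∈ Submodule.span ℝ (Set.range ![S.F x, pd du S.F x, pd dv S.F x, a x, b x]) := by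
    rw [hspan]; trivial
  have hle : Submodule.span ℝ (Set.range ![S.F x, pd du S.F x, pd dv S.F x, a x, b x])
      ≤ LinearMap.ker (minkBilin 3 (S.F x)).toLinearMap := by
    rw [Submodule.span_le]
    rintro _ ⟨i, rfl⟩
    fin_cases i <;> simp [minkBilin_apply, *, S.F_null]
  simpa [minkBilin_apply] using hle hz

/-- In `S³`, top coefficients of conserved quantities are proportional. -/
lemma exists_eq_smul_top {S : IsothermicSurface 3} {a a' b b' : Surf → MV 3}
    (ha : ContDiff ℝ (⊤ : ℕ∞) a) (hb : ContDiff ℝ (⊤ : ℕ∞) b) (h : S.DerivEq a a')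
    (h' : S.DerivEq b b') (hk : S.EtaKills a) (hk' : S.EtaKills b) (ha0 : a ≠ 0) :
    ∃ c : ℝ, ∀ x, b x = c • a x := by
  obtain ⟨x₀, hx₀⟩ := S.eta_ne
  have haa := mink_top_const ha ha h h hk hk
  have hab := mink_top_const ha hb h h' hk hk'
  have hbb := mink_top_const hb hb h' h' hk' hk'
  have hne : mink 3 (a x₀) (a x₀) ≠ 0 := fun h0 =>
    ha0 (eq_zero_of_null ha h hk fun x => (haa x x₀).trans h0)
  have hg := gram_top_eq_zero ha hb h h' hk hk' hx₀
  set c := mink 3 (a x₀) (b x₀) / mink 3 (a x₀) (a x₀) with hc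
  refine ⟨c, fun x => ?_⟩
  have hda := ha.differentiable (by simp)
  have hdb := hb.differentiable (by simp)
  have := eq_zero_of_null (S := S) (a := fun x => b x - c • a x) (b := fun x => b' x - c • a' x)
    (hb.sub (ha.const_smul c)) (fun y => ?_) (fun y => ?_) (fun y => ?_)
  · exact sub_eq_zero.1 (congrFun this x)
  · rw [fderiv_fun_sub (hdb y) ((hda y).fun_const_smul c), fderiv_fun_const_smul (hda y)]
    simp only [wedge_sub, wedge_smul, _root_.sub_apply,
      _root_.smul_apply]
    constructor
    · linear_combination (norm := module) (h' y).1 - c • (h y).1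
    · linear_combination (norm := module) (h' y).2 - c • (h y).2
  · simp [wedge_sub, wedge_smul, (hk y).1, (hk y).2, (hk' y).1, (hk' y).2]
  · simp only [mink_sub_left, mink_sub_right, mink_smul_left, mink_smul_right,
      mink_comm 3 (b y) (a y), haa y x₀, hab y x₀, hbb y x₀]
    rw [hc]; field_simp; linear_combination hg

/-- The coefficients of `t • ∑ cₖ tᵏ`. -/
def shift (c : ℕ → Surf → MV n) : ℕ → Surf → MV n
  | 0 => 0
  | k + 1 => c k

lemma sum_shift (c : ℕ → Surf → MV n) (N : ℕ) (t : ℝ) (x : Surf) :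
    ∑ k ∈ range (N + 1), t ^ k • shift c k x = t • ∑ k ∈ range N, t ^ k • c k x := by
  rw [sum_range_succ', smul_sum]
  simp [shift, pow_succ', mul_smul]

lemma contDiff_shift {c : ℕ → Surf → MV n} (hc : ∀ k, ContDiff ℝ (⊤ : ℕ∞) (c k)) (k : ℕ) :
    ContDiff ℝ (⊤ : ℕ∞) (shift c k) := by
  cases k with
  | zero => exact contDiff_const
  | succ k => exact hc k

lemma contDiff_sum_pow_smul {c : ℕ → Surf → MV n} (hc : ∀ k, ContDiff ℝ (⊤ : ℕ∞) (c k))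
    (N : ℕ) (t : ℝ) : ContDiff ℝ (⊤ : ℕ∞) fun x => ∑ k ∈ range N, t ^ k • c k x :=
  ContDiff.sum fun k _ => (hc k).const_smul _

lemma sum_range_of_le {c : ℕ → Surf → MV n} {N M : ℕ} (hz : ∀ k, N < k → c k = 0)
    (h : N + 1 ≤ M) (t : ℝ) (x : Surf) :
    ∑ k ∈ range M, t ^ k • c k x = ∑ k ∈ range (N + 1), t ^ k • c k x :=
  eventually_constant_sum (fun k hk => by simp [hz k hk]) h

lemma deriv_sum_add {c : ℕ → Surf → MV n} (hc : ∀ k, ContDiff ℝ (⊤ : ℕ∞) (c k)) {N : ℕ}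
    (hz : ∀ k, N < k → c k = 0) (t : ℝ) (x e : Surf) (u W : MV n) :
    fderiv ℝ (fun x => ∑ k ∈ range (N + 1), t ^ k • c k x) x e
        + t • wedge n u W (∑ k ∈ range (N + 1), t ^ k • c k x)
      = ∑ k ∈ range (N + 2), t ^ k • (fderiv ℝ (c k) x e + wedge n u W (shift c k x)) := by
  have hd : ∀ k, DifferentiableAt ℝ (c k) x := fun k => ((hc k).differentiable (by simp)) x
  simp only [smul_add, sum_add_distrib]
  congr 1
  · rw [fderiv_fun_sum fun k _ => (hd k).fun_const_smul _, sum_range_succ _ (N + 1),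
      hz (N + 1) (by omega)]
    simp [fderiv_fun_const_smul (hd _)]
  · rw [← wedge_smul, ← sum_shift, wedge_sum]
    simp only [wedge_smul]

lemma isConserved_of_parallel {c : ℕ → Surf → MV n} (hc : ∀ k, ContDiff ℝ (⊤ : ℕ∞) (c k))
    {N : ℕ} (hz : ∀ k, N < k → c k = 0) (m : ℝ)
    (h : ∀ t, t ≠ m → ParallelSection n S t fun x => ∑ k ∈ range (N + 1), t ^ k • c k x) :
    S.IsConserved c := by
  have key : ∀ x k, fderiv ℝ (c k) x du + wedge n (S.F x) (S.W₁ x) (shift c k x) = 0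
      ∧ fderiv ℝ (c k) x dv + wedge n (S.F x) (S.W₂ x) (shift c k x) = 0 := by
    intro x k
    obtain hk | ⟨hk, hk'⟩ : k < N + 2 ∨ c k = 0 ∧ shift c k = 0 := by
      by_cases hk : k < N + 2
      · exact Or.inl hk
      · obtain ⟨j, rfl⟩ : ∃ j, k = j + 1 := ⟨k - 1, by omega⟩
        exact Or.inr ⟨hz _ (by omega), hz j (by omega)⟩
    · constructor
      · refine coeff_eq_zero_of_sum_pow_smul m
          (fun k => fderiv ℝ (c k) x du + wedge n (S.F x) (S.W₁ x) (shift c k x))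
          (fun t ht => ?_) hk
        rw [← deriv_sum_add hc hz]
        exact (h t ht x).1
      · refine coeff_eq_zero_of_sum_pow_smul m
          (fun k => fderiv ℝ (c k) x dv + wedge n (S.F x) (S.W₂ x) (shift c k x))
          (fun t ht => ?_) hk
        rw [← deriv_sum_add hc hz]
        exact (h t ht x).2
    · simp [hk, hk', wedge_zero]
  refine ⟨hc, fun x => ?_, fun k x => key x (k + 1)⟩
  have := key x 0
  simp only [shift, Pi.zero_apply, wedge_zero, add_zero] at this
  exact fderiv_eq_zero_of_partials this.1 this.2

lemma _root_.PolyConservedQuantity.isConserved {d : ℕ} (p : PolyConservedQuantity n S d) :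
    S.IsConserved p.coeff :=
  isConserved_of_parallel p.smooth p.coeff_eq_zero 0 fun t _ => p.conserved t

namespace IsConserved

variable {c : ℕ → Surf → MV n}

/-- The polynomial conserved quantity of degree `N` with coefficients `c`. -/
def toPoly (h : S.IsConserved c) {N : ℕ} (hz : ∀ k, N < k → c k = 0) (hN : c N ≠ 0) :
    PolyConservedQuantity n S N where
  coeff := c
  smooth := h.smooth
  coeff_eq_zero := hz
  top_ne := hN
  conserved t x := by
    have key : ∀ k,
        fderiv ℝ (c k) x du
          + wedge n (S.F x) (S.W₁ x) (IsothermicSurface.shift c k x) = 0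
        ∧ fderiv ℝ (c k) x dv
          + wedge n (S.F x) (S.W₂ x) (IsothermicSurface.shift c k x) = 0 := by
      intro k
      cases k with
      | zero => simp [IsothermicSurface.shift, h.zero x, wedge_zero]
      | succ k => exact h.succ k x
    rw [deriv_sum_add h.smooth hz, deriv_sum_add h.smooth hz]
    exact ⟨sum_eq_zero fun k _ => by rw [(key k).1, smul_zero],
      sum_eq_zero fun k _ => by rw [(key k).2, smul_zero]⟩

protected lemma shift (h : S.IsConserved c) : S.IsConserved (IsothermicSurface.shift c) where
  smooth := contDiff_shift h.smooth
  zero x := by simp [IsothermicSurface.shift]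
  succ k x := by
    cases k with
    | zero => simp [IsothermicSurface.shift, h.zero x, wedge_zero]
    | succ k => exact h.succ k x

/-- A nonzero conserved quantity of degree at most `N` gives one of degree exactly `N`. -/
lemma specialOfType (h : S.IsConserved c) {N : ℕ} (hz : ∀ k, N < k → c k = 0)
    (hne : ∃ k, c k ≠ 0) : SpecialOfType n S N := by
  induction N with
  | zero =>
    obtain ⟨k, hk⟩ := hne
    obtain rfl : k = 0 := by
      by_contra h0
      exact hk (hz k (by omega))
    exact ⟨h.toPoly hz hk⟩
  | succ N ih =>
    by_cases hN : c (N + 1) = 0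
    · obtain ⟨p⟩ := ih fun k hk => by
        obtain rfl | hk := (Nat.succ_le_of_lt hk).eq_or_lt
        · exact hN
        · exact hz k hk
      refine ⟨p.isConserved.shift.toPoly (fun k hk => ?_) p.top_ne⟩
      obtain ⟨j, rfl⟩ : ∃ j, k = j + 1 := ⟨k - 1, by omega⟩
      exact p.coeff_eq_zero j (by omega)
    · exact ⟨h.toPoly hz hN⟩

lemma etaKills (h : S.IsConserved c) {k : ℕ} (hk : c (k + 1) = 0) : S.EtaKills (c k) := by
  intro x
  have := h.succ k x
  rw [hk] at this
  simpa using this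

lemma sub {b : ℕ → Surf → MV n} (hc : S.IsConserved c) (hb : S.IsConserved b) :
    S.IsConserved fun k x => c k x - b k x where
  smooth k := (hc.smooth k).sub (hb.smooth k)
  zero x := by
    rw [fderiv_fun_sub (((hc.smooth 0).differentiable (by simp)) x)
      (((hb.smooth 0).differentiable (by simp)) x), hc.zero, hb.zero, sub_zero]
  succ k x := by
    rw [fderiv_fun_sub (((hc.smooth _).differentiable (by simp)) x)
      (((hb.smooth _).differentiable (by simp)) x)]
    simp only [wedge_sub, _root_.sub_apply]
    constructor
    · linear_combination (norm := module) (hc.succ k x).1 - (hb.succ k x).1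
    · linear_combination (norm := module) (hc.succ k x).2 - (hb.succ k x).2

lemma const_smul (hc : S.IsConserved c) (r : ℝ) : S.IsConserved fun k x => r • c k x where
  smooth k := (hc.smooth k).const_smul r
  zero x := by
    rw [fderiv_fun_const_smul (((hc.smooth 0).differentiable (by simp)) x), hc.zero, smul_zero]
  succ k x := by
    rw [fderiv_fun_const_smul (((hc.smooth _).differentiable (by simp)) x)]
    simp only [wedge_smul, _root_.smul_apply, ← smul_add]
    exact ⟨by rw [(hc.succ k x).1, smul_zero], by rw [(hc.succ k x).2, smul_zero]⟩

/-- A conserved quantity without constant term is divisible by `t`. -/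
lemma tail (hc : S.IsConserved c) (h0 : c 0 = 0) : S.IsConserved fun k => c (k + 1) where
  smooth k := hc.smooth _
  zero x := by
    have := hc.succ 0 x
    simp only [h0, Pi.zero_apply, wedge_zero, add_zero] at this
    exact fderiv_eq_zero_of_partials this.1 this.2
  succ k := hc.succ _

end IsConserved

/-- In `S³`, if the type is exactly `d`, conserved quantities of degree at most `d` are
multiples of `p`. -/
lemma IsConserved.exists_eq_smul {S : IsothermicSurface 3} {d : ℕ} (hd : 1 ≤ d)
    (p : PolyConservedQuantity 3 S d) (hnot : ¬ SpecialOfType 3 S (d - 1))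
    {r : ℕ → Surf → MV 3} (hr : S.IsConserved r) (hz : ∀ k, d < k → r k = 0) :
    ∃ κ : ℝ, ∀ k x, r k x = κ • p.coeff k x := by
  obtain ⟨j, rfl⟩ : ∃ j, d = j + 1 := ⟨d - 1, by omega⟩
  obtain ⟨κ, hκ⟩ := exists_eq_smul_top (p.smooth (j + 1)) (hr.smooth (j + 1))
    (p.isConserved.succ j) (hr.succ j)
    (p.isConserved.etaKills (p.coeff_eq_zero _ (by omega))) (hr.etaKills (hz _ (by omega)))
    p.top_ne
  refine ⟨κ, fun k x => ?_⟩
  by_contra hne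
  refine hnot ((hr.sub (p.isConserved.const_smul κ)).specialOfType (fun i hi => ?_)
    ⟨k, fun h0 => hne (sub_eq_zero.1 (congrFun h0 x))⟩)
  funext y
  obtain rfl | hi := (Nat.succ_le_of_lt hi).eq_or_lt
  · simp [hκ y]
  · have hi' : j + 1 < i := by simpa using hi
    simp [hz i hi', p.coeff_eq_zero i hi']

end IsothermicSurface

/-- `c` times the inverse of `gaugeG n F G c`. -/
def scaledGaugeInv (n : ℕ) (F G : MV n) (c : ℝ) (z : MV n) : MV n :=
  (c ^ 2 * (mink n G z / mink n F G)) • F + (mink n F z / mink n F G) • G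
    + c • (z - (mink n G z / mink n F G) • F - (mink n F z / mink n F G) • G)

section Gauge

variable {n : ℕ} {F G : MV n} {c : ℝ}

lemma mink_scaledGaugeInv_left (hF : mink n F F = 0) (hFG : mink n F G ≠ 0) (z : MV n) :
    mink n F (scaledGaugeInv n F G c z) = mink n F z := by
  simp only [scaledGaugeInv, mink_add_right, mink_sub_right, mink_smul_right, hF]
  field_simp; ring

lemma mink_scaledGaugeInv_right (hG : mink n G G = 0) (hFG : mink n F G ≠ 0) (z : MV n) :
    mink n G (scaledGaugeInv n F G c z) = c ^ 2 * mink n G z := by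
  simp only [scaledGaugeInv, mink_add_right, mink_sub_right, mink_smul_right, hG, mink_comm n G F]
  field_simp; ring

lemma gaugeG_scaledGaugeInv (hF : mink n F F = 0) (hG : mink n G G = 0) (hFG : mink n F G ≠ 0)
    (hc : c ≠ 0) (z : MV n) : gaugeG n F G c (scaledGaugeInv n F G c z) = c • z := by
  rw [gaugeG, mink_scaledGaugeInv_left hF hFG, mink_scaledGaugeInv_right hG hFG, scaledGaugeInv]
  match_scalars <;> field_simp <;> ring

lemma eq_zero_of_gaugeG_eq_zero (hF : mink n F F = 0) (hG : mink n G G = 0)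
    (hFG : mink n F G ≠ 0) (hc : c ≠ 0) {z : MV n} (h : gaugeG n F G c z = 0) : z = 0 := by
  have e1 := congrArg (mink n G) h
  have e2 := congrArg (mink n F) h
  simp only [gaugeG, mink_add_right, mink_sub_right, mink_smul_right, hF, hG, mink_comm n G F,
    mink_zero_right] at e1 e2
  field_simp at e1 e2
  have h1 : mink n G z = 0 := by
    apply (mul_eq_zero.1 _).resolve_right hFG
    linear_combination e1
  have h2 : mink n F z = 0 := by
    apply (mul_eq_zero.1 _).resolve_left (mul_ne_zero hFG (pow_ne_zero 2 hc))
    linear_combination e2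
  simpa [gaugeG, h1, h2] using h

end Gauge

namespace PolyConservedQuantity

variable {n : ℕ} {T : IsothermicSurface n} {d : ℕ}

/-- The coefficients of `Γ(1 − t/m)⁻¹ (1 − t/m) p̂(t)`. -/
def pullback (ph : PolyConservedQuantity n T d) (F : Surf → MV n) (m : ℝ) (k : ℕ) (x : Surf) :
    MV n :=
  ph.coeff k x
    - m⁻¹ • IsothermicSurface.shift (fun k x => ph.coeff k x
        + (mink n (T.F x) (ph.coeff k x) / mink n (F x) (T.F x)) • F x
        - (mink n (F x) (ph.coeff k x) / mink n (F x) (T.F x)) • T.F x) k x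
    + m⁻¹ ^ 2 • IsothermicSurface.shift (IsothermicSurface.shift fun k x =>
        (mink n (T.F x) (ph.coeff k x) / mink n (F x) (T.F x)) • F x) k x

variable (ph : PolyConservedQuantity n T d) {F : Surf → MV n} (m : ℝ)

lemma contDiff_pullback (hF : ContDiff ℝ (⊤ : ℕ∞) F) (hFT : ∀ x, mink n (F x) (T.F x) ≠ 0)
    (k : ℕ) : ContDiff ℝ (⊤ : ℕ∞) (ph.pullback F m k) := by
  have hG := T.smooth_F
  have hA : ∀ k, ContDiff ℝ (⊤ : ℕ∞) fun x =>
      (mink n (T.F x) (ph.coeff k x) / mink n (F x) (T.F x)) • F x := fun k =>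
    ((hG.mink (ph.smooth k)).div (hF.mink hG) hFT).smul hF
  have hB : ∀ k, ContDiff ℝ (⊤ : ℕ∞) fun x =>
      (mink n (F x) (ph.coeff k x) / mink n (F x) (T.F x)) • T.F x := fun k =>
    ((hF.mink (ph.smooth k)).div (hF.mink hG) hFT).smul hG
  exact ((ph.smooth k).sub ((IsothermicSurface.contDiff_shift
    (fun k => ((ph.smooth k).add (hA k)).sub (hB k)) k).const_smul _)).add
    ((IsothermicSurface.contDiff_shift (IsothermicSurface.contDiff_shift hA) k).const_smul _)

lemma pullback_eq_zero (k : ℕ) (hk : d + 2 < k) : ph.pullback F m k = 0 := by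
  obtain ⟨j, rfl⟩ : ∃ j, k = j + 2 := ⟨k - 2, by omega⟩
  funext x
  simp [pullback, IsothermicSurface.shift, ph.coeff_eq_zero (j + 2) (by omega),
    ph.coeff_eq_zero (j + 1) (by omega), ph.coeff_eq_zero j (by omega), mink_zero_right]

lemma pullback_top (x : Surf) : ph.pullback F m (d + 2) x
    = (m⁻¹ ^ 2 * (mink n (T.F x) (ph.coeff d x) / mink n (F x) (T.F x))) • F x := by
  simp [pullback, IsothermicSurface.shift, ph.coeff_eq_zero (d + 2) (by omega),
    ph.coeff_eq_zero (d + 1) (by omega), mink_zero_right, mul_smul]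

lemma pullback_zero : ph.pullback F m 0 = ph.coeff 0 := by
  funext x; simp [pullback, IsothermicSurface.shift]

lemma sum_pullback (t : ℝ) (x : Surf) :
    ∑ k ∈ range (d + 3), t ^ k • ph.pullback F m k x
      = scaledGaugeInv n (F x) (T.F x) (1 - t / m) (pcEval ph t x) := by
  have hlin : ∀ u : MV n, ∑ k ∈ range (d + 1), t ^ k * mink n u (ph.coeff k x)
      = mink n u (pcEval ph t x) := by
    intro u
    rw [pcEval, mink_comm, mink_sum_left]
    simp [mink_smul_left, mink_comm n u]
  have hs : ∀ (u v : MV n) (r : ℝ), ∑ k ∈ range (d + 1), t ^ k • (mink n u (ph.coeff k x) / r) • v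
      = (mink n u (pcEval ph t x) / r) • v := by
    intro u v r
    rw [← hlin, sum_div, sum_smul]
    simp [smul_smul, mul_div_assoc]
  have hP : ∀ M, d + 1 ≤ M → ∑ k ∈ range M, t ^ k • ph.coeff k x = pcEval ph t x :=
    fun M hM => IsothermicSurface.sum_range_of_le ph.coeff_eq_zero hM t x
  have hs' : ∀ (u v : MV n) (r : ℝ) (M : ℕ), d + 1 ≤ M →
      ∑ k ∈ range M, t ^ k • (mink n u (ph.coeff k x) / r) • v
        = (mink n u (pcEval ph t x) / r) • v := by
    intro u v r M hM
    rw [← hs]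
    refine eventually_constant_sum (fun k hk => ?_) hM
    simp [ph.coeff_eq_zero k hk, mink_zero_right]
  simp only [pullback, smul_add, smul_sub, sum_add_distrib, sum_sub_distrib]
  simp only [smul_comm (_ ^ _ : ℝ) (m⁻¹ : ℝ), smul_comm (_ ^ _ : ℝ) (m⁻¹ ^ 2 : ℝ), ← smul_sum,
    IsothermicSurface.sum_shift]
  simp only [smul_add, smul_sub, sum_add_distrib, sum_sub_distrib]
  rw [hP _ (by omega), hP _ (by omega), hs' _ _ _ _ (by omega), hs' _ _ _ _ (by omega), hs,
    scaledGaugeInv]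
  match_scalars <;> ring

lemma isConserved_pullback {S : IsothermicSurface n} (hm : m ≠ 0) (hg : GaugeRel n S T m)
    (hST : ∀ x, mink n (S.F x) (T.F x) ≠ 0) : S.IsConserved (ph.pullback S.F m) := by
  have hsm := ph.contDiff_pullback m S.smooth_F hST
  refine IsothermicSurface.isConserved_of_parallel hsm (N := d + 2)
    (ph.pullback_eq_zero m) m fun t ht x => ?_
  have hc : 1 - t / m ≠ 0 := by
    rw [sub_ne_zero, ne_comm, Ne, div_eq_one_iff_eq hm]; exact ht
  have hgauge : ∀ y, gaugeG n (S.F y) (T.F y) (1 - t / m)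
      (∑ k ∈ range (d + 2 + 1), t ^ k • ph.pullback S.F m k y) = (1 - t / m) • pcEval ph t y := by
    intro y
    rw [sum_pullback, gaugeG_scaledGaugeInv (S.F_null y) (T.F_null y) (hST y) hc]
  have hph : DifferentiableAt ℝ (pcEval ph t) x :=
    ((IsothermicSurface.contDiff_sum_pow_smul ph.smooth _ t).differentiable (by simp)) x
  have hpar := ph.conserved t x
  have h := hg t ht _ (IsothermicSurface.contDiff_sum_pow_smul hsm (d + 2 + 1) t) x
  simp only [hgauge, fderiv_fun_const_smul hph, wedge_smul, _root_.smul_apply,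
    smul_comm t (1 - t / m), ← smul_add] at h
  refine ⟨eq_zero_of_gaugeG_eq_zero (S.F_null x) (T.F_null x) (hST x) hc (h.1.symm.trans ?_),
    eq_zero_of_gaugeG_eq_zero (S.F_null x) (T.F_null x) (hST x) hc (h.2.symm.trans ?_)⟩
  · exact (congrArg _ hpar.1).trans (smul_zero _)
  · exact (congrArg _ hpar.2).trans (smul_zero _)

lemma continuous_pcEval (x : Surf) : Continuous fun t => pcEval ph t x := by
  unfold pcEval; fun_prop

end PolyConservedQuantity

/-- Theorem: in `S³`, if `(Λ,η)` is special isothermic of type `d` but not of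
type `d−1` and a Darboux transform of it is special isothermic of type `d` with
`p̂(0) = p(0)`, then `p(m)` takes values in `Λ̂^⊥`. -/
theorem darboux_transform_type_preserved_necessary (d : ℕ) (hd : 1 ≤ d)
    (S : IsothermicSurface 3) (p : PolyConservedQuantity 3 S d)
    (hnot : ¬ SpecialOfType 3 S (d - 1)) (m : ℝ) (hm : m ≠ 0)
    (D : DarbouxTransform 3 S m) (T : IsothermicSurface 3)
    (hT : T.F = D.G) (hg : GaugeRel 3 S T m)
    (ph : PolyConservedQuantity 3 T d)
    (h0 : ∀ x, ph.coeff 0 x = p.coeff 0 x) :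
    ∀ x, mink 3 (pcEval p m x) (D.G x) = 0 := by
  have hST : ∀ x, mink 3 (S.F x) (T.F x) ≠ 0 := by
    intro x h
    apply D.disjoint x
    rw [← hT, eq_smul_of_null_of_orthogonal (S.F_null x) (S.F_ne x) (T.F_null x) h]
    exact Submodule.smul_mem _ _ (Submodule.mem_span_singleton_self _)
  set q := ph.pullback S.F m
  have hq : S.IsConserved q := ph.isConserved_pullback m hm hg hST
  have hqd2 : q (d + 2) = 0 := by
    refine IsothermicSurface.eq_zero_of_null (hq.smooth _) (hq.succ (d + 1))
      (hq.etaKills (ph.pullback_eq_zero m _ (by omega))) fun x => ?_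
    rw [show q (d + 2) x = _ from ph.pullback_top m x, mink_smul_left, mink_smul_right,
      S.F_null, mul_zero, mul_zero]
  have hqz : ∀ k, d + 1 < k → q k = 0 := by
    intro k hk
    obtain rfl | hk := (Nat.succ_le_of_lt hk).eq_or_lt
    · exact hqd2
    · exact ph.pullback_eq_zero m k hk
  have hq0 : q 0 = p.coeff 0 := (ph.pullback_zero m).trans (funext h0)
  have hr := (hq.sub p.isConserved).tail (by funext x; simp [hq0])
  obtain ⟨κ, hκ⟩ := hr.exists_eq_smul hd p hnot fun k hk => by
    funext x; simp [hqz (k + 1) (by omega), p.coeff_eq_zero (k + 1) (by omega)]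
  have hqk : ∀ k x, q k x = p.coeff k x + κ • IsothermicSurface.shift p.coeff k x := by
    intro k x
    cases k with
    | zero => simp [IsothermicSurface.shift, hq0]
    | succ k => exact eq_add_of_sub_eq' (hκ k x)
  intro x
  rw [← hT]
  have key : ∀ t, (1 + κ * t) * mink 3 (pcEval p t x) (T.F x)
      = (1 - t / m) ^ 2 * mink 3 (T.F x) (pcEval ph t x) := by
    intro t
    rw [← mink_scaledGaugeInv_right (T.F_null x) (hST x), ← ph.sum_pullback]
    have : ∑ k ∈ range (d + 3), t ^ k • q k x = (1 + κ * t) • pcEval p t x := by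
      simp only [hqk, smul_add, sum_add_distrib, smul_comm (_ ^ _ : ℝ) κ, ← smul_sum]
      rw [IsothermicSurface.sum_shift,
        IsothermicSurface.sum_range_of_le (M := d + 3) p.coeff_eq_zero (by omega),
        IsothermicSurface.sum_range_of_le (M := d + 2) p.coeff_eq_zero (by omega), pcEval]
      module
    rw [this, mink_smul_right, mink_comm]
  by_cases hκm : 1 + κ * m = 0
  · have hκ' : κ = -m⁻¹ := by field_simp; linear_combination hκm
    have hcont := (PolyConservedQuantity.continuous_pcEval p x)
    have hcont' := (PolyConservedQuantity.continuous_pcEval ph x)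
    have h := Continuous.ext_on (dense_compl_singleton m)
      (f := fun t => mink 3 (pcEval p t x) (T.F x))
      (g := fun t => (1 - t / m) * mink 3 (T.F x) (pcEval ph t x))
      (by simp only [← minkBilin_apply]; fun_prop) (by simp only [← minkBilin_apply]; fun_prop)
      fun t ht => by
        have hc : 1 - t / m ≠ 0 := by
          rw [sub_ne_zero, ne_comm, Ne, div_eq_one_iff_eq hm]; exact ht
        apply mul_left_cancel₀ hc
        have := key t
        rw [hκ'] at this
        linear_combination this
    simpa [div_self hm] using congrFun h m
  · apply (mul_eq_zero.1 _).resolve_left hκm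
    rw [key m, div_self hm, sub_self]; ring
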